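/- arXiv:1904.01285 — 2 statements merged into one kernel-verified Lean document; each statement's English description precedes it below -/
import Mathlib

section
/- Let X and Y be first-countable topological spaces, f : X → Y an open quotient map, E ⊆ Y² a symmetric reflexive closed relation, F = (f × f)⁻¹(E), k ≥ 1 an integer, and λ a successor ordinal. Then (E^[k])² is contained in the closure of (E^(λ-1))^[2k] ∩ (E^[k])² if and only if (F^[k])² is contained in the closure of (F^(λ-1))^[2k] ∩ (F^[k])². -/
open Filter Topology Set

namespace CPE

universe u

/-- The left shift map on bi-infinite sequences: `(σ x) i = x (i+1)`. -/
def shiftMap {A : Type*} (x : ℤ → A) : ℤ → A := fun i => x (i + 1)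

/-- The shift by `m`: `(σ^m x) i = x (i + m)`. -/
def shiftZ {A : Type*} (m : ℤ) (x : ℤ → A) : ℤ → A := fun i => x (i + m)

/-- A subshift: a closed shift-invariant subset of the full shift. -/
def IsSubshift {A : Type*} [TopologicalSpace A] (X : Set (ℤ → A)) : Prop :=
  IsClosed X ∧ shiftMap '' X = X

/-- The orbit closure of a point. -/
def orbitClosure {A : Type*} [TopologicalSpace A] (x : ℤ → A) : Set (ℤ → A) :=
  closure {y | ∃ m : ℤ, y = shiftZ m x}

/-- A Toeplitz point: every coordinate repeats along some arithmetic progression. -/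
def IsToeplitz {A : Type*} (x : ℤ → A) : Prop :=
  ∀ i : ℤ, ∃ n : ℕ, 0 < n ∧ ∀ m : ℤ, x (i + m * n) = x i

/-- A minimal subshift: a nonempty subshift with no nonempty proper subshift. -/
def IsMinimalSubshift {A : Type*} [TopologicalSpace A] (M : Set (ℤ → A)) : Prop :=
  IsSubshift M ∧ M.Nonempty ∧ ∀ M' ⊆ M, IsSubshift M' → M'.Nonempty → M' = M

/-- The words of length `n` appearing in points of `X`. -/
def lang {A : Type*} (X : Set (ℤ → A)) (n : ℕ) : Set (Fin n → A) :=
  {w | ∃ x ∈ X, ∀ i : Fin n, x (i : ℤ) = w i}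

/-- `X` has zero (topological) entropy: `lim (log |L_n(X)|)/n = 0`. -/
def HasZeroEntropy {A : Type*} (X : Set (ℤ → A)) : Prop :=
  Tendsto (fun n : ℕ => Real.log ((lang X n).ncard) / n) atTop (nhds 0)

/-- `N(𝒰 ∨ σ⁻¹𝒰 ∨ ⋯ ∨ σ^{-(n-1)}𝒰)` for the two-element cover `𝒰 = (C0, C1)`:
the minimal number of sets of the form `⋂_{i<n} σ^{-i} C_{u i}` needed to cover `X`. -/
noncomputable def coverNum {A : Type*} (X C0 C1 : Set (ℤ → A)) (n : ℕ) : ℕ :=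
  sInf {m | ∃ S : Finset (Fin n → Bool), S.card = m ∧
    X ⊆ ⋃ u ∈ S, ⋂ i : Fin n, shiftMap^[(i : ℕ)] ⁻¹' (if u i then C1 else C0)}

/-- The topological entropy `h(𝒰)` of the two-element cover `𝒰 = (C0, C1)` of a subshift `X`.
By subadditivity (Fekete's lemma) the limit `lim_n (1/n) log N_n` exists and equals the
infimum `⨅_{n ≥ 1} (1/n) log N_n`, which we use as the definition. -/
noncomputable def coverEntropy {A : Type*} (X C0 C1 : Set (ℤ → A)) : ℝ :=
  ⨅ n : ℕ, Real.log (coverNum X C0 C1 (n + 1)) / (n + 1)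

/-- `(x, y)` is an entropy pair of the subshift `X`: `x ≠ y` and for all disjoint closed
neighborhoods `U` of `x` and `V` of `y` (in `X`), the cover `(Uᶜ, Vᶜ)` has positive entropy. -/
def IsEntropyPair {A : Type*} [TopologicalSpace A] (X : Set (ℤ → A)) (x y : ℤ → A) : Prop :=
  x ∈ X ∧ y ∈ X ∧ x ≠ y ∧
    ∀ U V : Set (ℤ → A), IsClosed U → IsClosed V → U ∈ nhdsWithin x X → V ∈ nhdsWithin y X →
      Disjoint U V → 0 < coverEntropy X Uᶜ Vᶜ

/-- `EP(X)`: the entropy pairs of `X` together with the diagonal on `X`. -/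
def EP {A : Type*} [TopologicalSpace A] (X : Set (ℤ → A)) : Set ((ℤ → A) × (ℤ → A)) :=
  {p | IsEntropyPair X p.1 p.2} ∪ {p | p.1 ∈ X ∧ p.1 = p.2}

/-- The close-up process on a relation `E`: `E^(0) = E`; at a successor step `α + 1` one takes
the topological closure if `α + 1` is odd (i.e. `α` is even), and the transitive closure if
`α + 1` is even (i.e. `α` is odd); at limit steps one takes the union.  (An ordinal is even
iff it is of the form `λ + 2n` with `λ` a limit ordinal and `n ∈ ℕ`, iff its residue mod `2`
is `0`.)  When `E` is closed this agrees with the process of Barbieri–García-Ramos started at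
`E^(1) = E`, since then `E^(1) = closure E = E`. -/
noncomputable def closeUp {α : Type u} [TopologicalSpace α] (E : Set (α × α))
    (o : Ordinal.{u}) : Set (α × α) :=
  Ordinal.limitRecOn o E
    (fun β ih => if β % 2 = 0 then closure ih
      else {p | Relation.TransGen (fun a b => (a, b) ∈ ih) p.1 p.2})
    (fun β _ ih => ⋃ γ : Set.Iio β, ih γ.1 γ.2)

/-- The close-up rank of `E`: the least ordinal `λ` (with `λ ≥ 1` if `E` is closed, matching
the convention `E^(ζ) = E`, `ζ = 1` for closed `E`) such that `E^(λ) = E^(λ+1)`. -/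
noncomputable def closeUpRank {α : Type u} [TopologicalSpace α] (E : Set (α × α)) :
    Ordinal.{u} :=
  sInf {o | (IsClosed E → 1 ≤ o) ∧ closeUp E o = closeUp E (o + 1)}

/-- `E^[k] = {(x₁, …, x_k) : ∀ i j, (x_i, x_j) ∈ E}`. -/
def relPow {α : Type*} (E : Set (α × α)) (k : ℕ) : Set (Fin k → α) :=
  {v | ∀ i j, (v i, v j) ∈ E}

/-- `(E^[k])²` viewed inside `α^{k+k}` via concatenation of the two `k`-tuples. -/
def pairSet {α : Type*} (E : Set (α × α)) (k : ℕ) : Set (Fin (k + k) → α) :=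
  {w | ∃ u ∈ relPow E k, ∃ v ∈ relPow E k, w = Fin.append u v}

end CPE

namespace CPE

universe u

theorem transGen_preimage_iff {α β : Type*} {f : α → β} (hf : f.Surjective) (R : Set (β × β))
    (a b : α) :
    Relation.TransGen (fun x y => (x, y) ∈ Prod.map f f ⁻¹' R) a b ↔
      Relation.TransGen (fun x y => (x, y) ∈ R) (f a) (f b) := by
  refine ⟨fun h => h.lift f fun _ _ h => h, fun h => ?_⟩
  generalize hc : f b = c at h
  induction h generalizing b with
  | single h => subst hc; exact .single h
  | @tail d _ _ h ih =>
    subst hc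
    obtain ⟨x, rfl⟩ := hf d
    exact (ih x rfl).tail h

theorem closeUp_preimage {X Y : Type u} [TopologicalSpace X] [TopologicalSpace Y] {f : X → Y}
    (hf : Continuous f) (hsurj : f.Surjective) (hopen : IsOpenMap f) (E : Set (Y × Y))
    (o : Ordinal.{u}) :
    closeUp (Prod.map f f ⁻¹' E) o = Prod.map f f ⁻¹' closeUp E o := by
  induction o using Ordinal.limitRecOn with
  | zero => simp only [closeUp, Ordinal.limitRecOn_zero]
  | add_one β ih =>
    unfold closeUp at ih ⊢
    rw [Ordinal.limitRecOn_add_one, Ordinal.limitRecOn_add_one, ih]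
    split_ifs
    · exact ((hopen.prodMap hopen).preimage_closure_eq_closure_preimage (hf.prodMap hf) _).symm
    · ext p
      exact transGen_preimage_iff hsurj _ p.1 p.2
  | limit β hβ ih =>
    unfold closeUp at ih ⊢
    rw [Ordinal.limitRecOn_limit _ _ _ _ hβ, Ordinal.limitRecOn_limit _ _ _ _ hβ,
      Set.preimage_iUnion]
    exact Set.iUnion_congr fun γ => ih γ.1 γ.2

theorem relPow_preimage {X Y : Type*} (f : X → Y) (E : Set (Y × Y)) (k : ℕ) :
    relPow (Prod.map f f ⁻¹' E) k = (Pi.map fun _ => f) ⁻¹' relPow E k := rfl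

theorem mem_pairSet_iff {α : Type*} {E : Set (α × α)} {k : ℕ} {w : Fin (k + k) → α} :
    w ∈ pairSet E k ↔
      (fun i => w (Fin.castAdd k i)) ∈ relPow E k ∧ (fun i => w (Fin.natAdd k i)) ∈ relPow E k := by
  constructor
  · rintro ⟨u, hu, v, hv, rfl⟩
    simp only [Fin.append_left, Fin.append_right]
    exact ⟨hu, hv⟩
  · rintro ⟨hu, hv⟩
    exact ⟨_, hu, _, hv, Fin.append_castAdd_natAdd.symm⟩

theorem pairSet_preimage {X Y : Type*} (f : X → Y) (E : Set (Y × Y)) (k : ℕ) :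
    pairSet (Prod.map f f ⁻¹' E) k = (Pi.map fun _ => f) ⁻¹' pairSet E k := by
  ext w
  simp only [Set.mem_preimage, mem_pairSet_iff]
  rfl

end CPE

open CPE Filter Topology in
/-- If `f : X → Y` is an open quotient map between first-countable spaces, `E ⊆ Y²` a
symmetric reflexive closed relation, `F = (f × f)⁻¹(E)`, `k ≥ 1` and `λ = μ + 1` a successor
ordinal, then the odd condition `(E^[k])² ⊆ closure ((E^(λ-1))^[2k] ∩ (E^[k])²)` holds for `E`
iff the corresponding condition holds for `F`. -/
theorem odd_condition_preimage_open_quotient {X Y : Type u}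
    [TopologicalSpace X] [TopologicalSpace Y]
    [FirstCountableTopology X] [FirstCountableTopology Y]
    (f : X → Y) (hq : Topology.IsQuotientMap f) (hopen : IsOpenMap f)
    (E : Set (Y × Y)) (hEclosed : IsClosed E)
    (hEsym : ∀ p ∈ E, (p.2, p.1) ∈ E) (hErefl : ∀ y : Y, (y, y) ∈ E)
    (k : ℕ) (hk : 1 ≤ k) (lam mu : Ordinal.{u}) (hlam : lam = mu + 1) :
    (pairSet E k ⊆ closure (relPow (closeUp E mu) (k + k) ∩ pairSet E k)) ↔
      (pairSet (Prod.map f f ⁻¹' E) k ⊆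
        closure (relPow (closeUp (Prod.map f f ⁻¹' E) mu) (k + k)
          ∩ pairSet (Prod.map f f ⁻¹' E) k)) := by
  have hsurj : Function.Surjective (Pi.map fun _ : Fin (k + k) => f) :=
    Function.Surjective.piMap fun _ => hq.surjective
  have hcont : Continuous (Pi.map fun _ : Fin (k + k) => f) :=
    Continuous.piMap fun _ => hq.continuous
  have hmap : IsOpenMap (Pi.map fun _ : Fin (k + k) => f) :=
    IsOpenMap.piMap (fun _ => hopen) (Filter.Eventually.of_forall fun _ => hq.surjective)
  rw [closeUp_preimage hq.continuous hq.surjective hopen, relPow_preimage, pairSet_preimage,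
    ← Set.preimage_inter, ← hmap.preimage_closure_eq_closure_preimage hcont,
    hsurj.preimage_subset_preimage_iff]
end

section
/- Let X be a topological space and E ⊆ X² a symmetric reflexive relation. Then there exists an ordinal λ such that E^(μ) = E^(λ) for all ordinals μ ≥ λ, and this stable relation E^(λ) is the smallest closed equivalence relation on X containing E (i.e., it is a closed equivalence relation containing E, and it is contained in every closed equivalence relation containing E). -/
open Filter Topology Set

namespace CPE

universe u

section CloseUp

variable {X : Type u} [TopologicalSpace X] (E : Set (X × X))

theorem closeUp_zero : closeUp E 0 = E :=
  Ordinal.limitRecOn_zero ..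

theorem closeUp_add_one_of_mod_eq_zero {o : Ordinal.{u}} (ho : o % 2 = 0) :
    closeUp E (o + 1) = closure (closeUp E o) := by
  unfold closeUp
  rw [Ordinal.limitRecOn_add_one, if_pos ho]

theorem closeUp_add_one_of_mod_ne_zero {o : Ordinal.{u}} (ho : o % 2 ≠ 0) :
    closeUp E (o + 1) =
      {p | Relation.TransGen (fun a b => (a, b) ∈ closeUp E o) p.1 p.2} := by
  unfold closeUp
  rw [Ordinal.limitRecOn_add_one, if_neg ho]

theorem closeUp_limit {o : Ordinal.{u}} (ho : Order.IsSuccLimit o) :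
    closeUp E o = ⋃ γ : Set.Iio o, closeUp E γ := by
  unfold closeUp
  rw [Ordinal.limitRecOn_limit _ _ _ _ ho]

/-- A property stable under closures, transitive closures and unions of nonempty families passes
from `E` to every stage of the close-up process. -/
theorem closeUp_induction {P : Set (X × X) → Prop} (hE : P E)
    (hclosure : ∀ R, P R → P (closure R))
    (htrans : ∀ R, P R → P {p | Relation.TransGen (fun a b => (a, b) ∈ R) p.1 p.2})
    (hunion : ∀ (ι : Type (u + 1)) [Nonempty ι] (R : ι → Set (X × X)),
      (∀ i, P (R i)) → P (⋃ i, R i))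
    (o : Ordinal.{u}) : P (closeUp E o) := by
  induction o using Ordinal.limitRecOn with
  | zero => rwa [closeUp_zero]
  | add_one o ih =>
    by_cases ho : o % 2 = 0
    · rw [closeUp_add_one_of_mod_eq_zero E ho]
      exact hclosure _ ih
    · rw [closeUp_add_one_of_mod_ne_zero E ho]
      exact htrans _ ih
  | limit o ho ih =>
    rw [closeUp_limit E ho]
    have : Nonempty (Set.Iio o) := ⟨⟨0, ho.bot_lt⟩⟩
    exact hunion _ _ fun γ => ih γ γ.2

theorem closeUp_subset_add_one (o : Ordinal.{u}) : closeUp E o ⊆ closeUp E (o + 1) := by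
  by_cases ho : o % 2 = 0
  · rw [closeUp_add_one_of_mod_eq_zero E ho]
    exact subset_closure
  · rw [closeUp_add_one_of_mod_ne_zero E ho]
    exact fun p hp => Relation.TransGen.single hp

theorem closeUp_mono : Monotone (closeUp E) := by
  intro a b
  induction b using Ordinal.limitRecOn with
  | zero => exact fun h => (le_antisymm h zero_le) ▸ le_rfl
  | add_one b ih =>
    intro h
    rcases h.eq_or_lt with rfl | h
    · exact le_rfl
    · exact (ih (Order.lt_add_one_iff.1 h)).trans (closeUp_subset_add_one E b)
  | limit b hb _ =>
    intro h
    rcases h.eq_or_lt with rfl | h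
    · exact le_rfl
    · rw [closeUp_limit E hb]
      exact Set.subset_iUnion (fun γ : Set.Iio b => closeUp E γ) ⟨a, h⟩

theorem closeUp_symm (hsym : ∀ p ∈ E, (p.2, p.1) ∈ E) (o : Ordinal.{u}) :
    ∀ p ∈ closeUp E o, (p.2, p.1) ∈ closeUp E o := by
  refine closeUp_induction E (P := fun R => ∀ p ∈ R, (p.2, p.1) ∈ R) hsym ?_ ?_ ?_ o
  · exact fun R hR p hp => map_mem_closure (f := Prod.swap) continuous_swap hp hR
  · intro R hR p hp
    have : Std.Symm fun a b => (a, b) ∈ R := ⟨fun a b h => hR (a, b) h⟩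
    exact Relation.TransGen.stdSymm.symm _ _ hp
  · intro ι _ R hR p hp
    obtain ⟨i, hi⟩ := Set.mem_iUnion.1 hp
    exact Set.mem_iUnion.2 ⟨i, hR i p hi⟩

theorem closeUp_subset {F : Set (X × X)} (hF : IsClosed F)
    (htrans : ∀ a b c : X, (a, b) ∈ F → (b, c) ∈ F → (a, c) ∈ F) (hE : E ⊆ F)
    (o : Ordinal.{u}) : closeUp E o ⊆ F := by
  refine closeUp_induction E (P := fun R => R ⊆ F) hE ?_ ?_ ?_ o
  · exact fun R hR => closure_minimal hR hF
  · rintro R hR ⟨a, b⟩ hp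
    change Relation.TransGen _ a b at hp
    induction hp with
    | single h => exact hR h
    | tail _ h ih => exact htrans _ _ _ ih (hR h)
  · exact fun ι _ R hR => Set.iUnion_subset hR

/-- Some stage of the close-up process is closed and transitive. -/
theorem exists_closeUp_isClosed_and_trans :
    ∃ o : Ordinal.{u}, IsClosed (closeUp E o) ∧
      ∀ a b c : X, (a, b) ∈ closeUp E o → (b, c) ∈ closeUp E o → (a, c) ∈ closeUp E o := by
  obtain ⟨a, b, hab, hlt⟩ : ∃ a b : Ordinal.{u},
      closeUp E (2 * a) = closeUp E (2 * b) ∧ a < b := by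
    have hninj := not_injective_of_ordinal (fun o : Ordinal.{u} => closeUp E (2 * o))
    simp only [Function.Injective, not_forall] at hninj
    obtain ⟨a, b, hab, hne⟩ := hninj
    rcases lt_or_gt_of_ne hne with h | h
    · exact ⟨a, b, hab, h⟩
    · exact ⟨b, a, hab.symm, h⟩
  have hle : 2 * a + 1 + 1 ≤ 2 * b := by
    have h : 2 * (a + 1) ≤ 2 * b := mul_le_mul_right (Order.add_one_le_of_lt hlt) 2
    rwa [mul_add, mul_one, ← one_add_one_eq_two, ← add_assoc, one_add_one_eq_two] at h
  have heven : (2 * a) % 2 = 0 := Ordinal.mul_mod 2 a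
  have hodd : (2 * a + 1) % 2 ≠ 0 := by
    rw [Ordinal.mul_add_mod_self, Ordinal.mod_eq_of_lt one_lt_two]
    exact one_ne_zero
  have h1 : closeUp E (2 * a + 1) = closeUp E (2 * a) :=
    le_antisymm (hab ▸ closeUp_mono E (le_self_add.trans hle)) (closeUp_subset_add_one E _)
  have h2 : closeUp E (2 * a + 1 + 1) ⊆ closeUp E (2 * a) := hab ▸ closeUp_mono E hle
  rw [closeUp_add_one_of_mod_ne_zero E hodd, h1] at h2
  rw [closeUp_add_one_of_mod_eq_zero E heven] at h1
  exact ⟨2 * a, closure_eq_iff_isClosed.1 h1,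
    fun x y z hxy hyz => @h2 (x, z) (Relation.TransGen.tail (.single hxy) hyz)⟩

end CloseUp

end CPE

open CPE in
/-- For any symmetric reflexive relation `E` on a topological space `X`, the close-up process
stabilizes at some ordinal `λ`, and the stable relation `E^(λ)` is the smallest closed
equivalence relation on `X` containing `E`. -/
theorem closeUp_stabilizes_at_smallest_closed_equivalence {X : Type u} [TopologicalSpace X]
    (E : Set (X × X)) (hsym : ∀ p ∈ E, (p.2, p.1) ∈ E) (hrefl : ∀ x : X, (x, x) ∈ E) :
    ∃ lam : Ordinal.{u},
      (∀ mu : Ordinal.{u}, lam ≤ mu → closeUp E mu = closeUp E lam) ∧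
      IsClosed (closeUp E lam) ∧
      (∀ x : X, (x, x) ∈ closeUp E lam) ∧
      (∀ p ∈ closeUp E lam, (p.2, p.1) ∈ closeUp E lam) ∧
      (∀ a b c : X, (a, b) ∈ closeUp E lam → (b, c) ∈ closeUp E lam → (a, c) ∈ closeUp E lam) ∧
      E ⊆ closeUp E lam ∧
      (∀ F : Set (X × X), IsClosed F → (∀ x : X, (x, x) ∈ F) → (∀ p ∈ F, (p.2, p.1) ∈ F) →
        (∀ a b c : X, (a, b) ∈ F → (b, c) ∈ F → (a, c) ∈ F) → E ⊆ F →
        closeUp E lam ⊆ F) := by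
  have hsub : ∀ o, E ⊆ closeUp E o := fun o =>
    (closeUp_zero E).symm.trans_le (closeUp_mono E zero_le)
  obtain ⟨lam, hclosed, htrans⟩ := exists_closeUp_isClosed_and_trans E
  exact ⟨lam,
    fun mu hmu => (closeUp_subset E hclosed htrans (hsub lam) mu).antisymm (closeUp_mono E hmu),
    hclosed, fun x => hsub lam (hrefl x), closeUp_symm E hsym lam, htrans, hsub lam,
    fun F hF _ _ hFtrans hEF => closeUp_subset E hF hFtrans hEF lam⟩
end
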